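/- arXiv:1503.07376 — 2 statements merged into one kernel-verified Lean document; each statement's English description precedes it below -/
import Mathlib

section
/- (Lemma 1, passivity of the bilinear incremental model) Consider the bilinear system ẋ = Ax + d + Σᵢ₌₁ᵐ uᵢBᵢx and an admissible trajectory x⋆ with control u⋆. Suppose there exists P = Pᵀ > 0 with sym(PA) ≤ 0 (negative semidefinite) and sym(PBᵢ) = 0 for all i. Define x̃ := x − x⋆, ũ := u − u⋆, V(x̃) := (1/2)x̃ᵀPx̃ and y := C(x⋆)x where the i-th row of C(x⋆) is x⋆ᵀBᵢᵀP. Then along any differentiable solution, (d/dt)V(x̃(t)) ≤ ũ(t)ᵀy(t) for all t. -/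
open Matrix

/-- The symmetric part of a square real matrix: `sym M = (1/2)(M + Mᵀ)`. -/
noncomputable def sym {k : ℕ} (M : Matrix (Fin k) (Fin k) ℝ) : Matrix (Fin k) (Fin k) ℝ :=
  (1 / 2 : ℝ) • (M + Mᵀ)

theorem dotProduct_sym_mulVec {k : ℕ} (M : Matrix (Fin k) (Fin k) ℝ) (z : Fin k → ℝ) :
    z ⬝ᵥ (sym M *ᵥ z) = z ⬝ᵥ (M *ᵥ z) := by
  have h : z ⬝ᵥ (Mᵀ *ᵥ z) = z ⬝ᵥ (M *ᵥ z) := by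
    rw [mulVec_transpose, dotProduct_comm, dotProduct_mulVec]
  simp only [sym, smul_mulVec, add_mulVec, dotProduct_smul, dotProduct_add, h, smul_eq_mul]
  ring

theorem HasDerivAt.dotProduct {k : ℕ} {f g : ℝ → Fin k → ℝ} {f' g' : Fin k → ℝ} {t : ℝ}
    (hf : HasDerivAt f f' t) (hg : HasDerivAt g g' t) :
    HasDerivAt (fun s => f s ⬝ᵥ g s) (f' ⬝ᵥ g t + f t ⬝ᵥ g') t := by
  simp only [_root_.dotProduct, ← Finset.sum_add_distrib]
  exact HasDerivAt.fun_sum fun i _ => (hasDerivAt_pi.1 hf i).mul (hasDerivAt_pi.1 hg i)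

theorem HasDerivAt.mulVec {k : ℕ} (M : Matrix (Fin k) (Fin k) ℝ) {f : ℝ → Fin k → ℝ}
    {f' : Fin k → ℝ} {t : ℝ} (hf : HasDerivAt f f' t) :
    HasDerivAt (fun s => M *ᵥ f s) (M *ᵥ f') t :=
  (LinearMap.toContinuousLinearMap M.mulVecLin).hasFDerivAt.comp_hasDerivAt t hf

/-- The derivative of the storage function along a differentiable curve. -/
theorem HasDerivAt.half_quadraticForm {k : ℕ} {P : Matrix (Fin k) (Fin k) ℝ} (hP : Pᵀ = P)
    {z : ℝ → Fin k → ℝ} {z' : Fin k → ℝ} {t : ℝ} (hz : HasDerivAt z z' t) :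
    HasDerivAt (fun s => (1 / 2 : ℝ) * (z s ⬝ᵥ (P *ᵥ z s))) (z t ⬝ᵥ (P *ᵥ z')) t := by
  have hsymm : z' ⬝ᵥ (P *ᵥ z t) = z t ⬝ᵥ (P *ᵥ z') := by
    rw [dotProduct_mulVec, ← mulVec_transpose, hP, dotProduct_comm]
  refine ((hz.dotProduct (hz.mulVec P)).const_mul (1 / 2 : ℝ)).congr_deriv ?_
  rw [hsymm]
  ring

/-- If `sym M = 0`, only the input mismatch contributes to the incremental power. -/
theorem sub_dotProduct_mulVec_of_sym_eq_zero {k : ℕ} {M : Matrix (Fin k) (Fin k) ℝ}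
    (hM : sym M = 0) (a b : Fin k → ℝ) (p q : ℝ) :
    (a - b) ⬝ᵥ (M *ᵥ (p • a - q • b)) = (p - q) * (a ⬝ᵥ (M *ᵥ b)) := by
  have hz (z : Fin k → ℝ) : z ⬝ᵥ (M *ᵥ z) = 0 := by
    rw [← dotProduct_sym_mulVec, hM, zero_mulVec, dotProduct_zero]
  have hab := hz (a - b)
  simp only [mulVec_sub, mulVec_smul, dotProduct_sub, sub_dotProduct, dotProduct_smul,
    smul_eq_mul, hz] at hab ⊢
  linear_combination p * hab

/-- **Lemma 1: passivity of the bilinear incremental model.**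
Under Assumption 1 (`P = Pᵀ > 0`, `sym(P A) ≤ 0`, `sym(P Bᵢ) = 0`), for any differentiable
solution `x` of the bilinear system and admissible trajectory `x⋆` (bounded, with bounded
control `u⋆`), the storage function `V(x̃) = (1/2) x̃ᵀ P x̃` along trajectories satisfies
`(d/dt) V(x̃(t)) ≤ ũ(t)ᵀ y(t)`, where `yᵢ = x⋆ᵀ Bᵢᵀ P x` and `ũ = u − u⋆`. -/
theorem stmt_4 {n m : ℕ}
    (A : Matrix (Fin n) (Fin n) ℝ) (B : Fin m → Matrix (Fin n) (Fin n) ℝ)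
    (P : Matrix (Fin n) (Fin n) ℝ) (hP : P.PosDef)
    (hPA : (-sym (P * A)).PosSemidef)
    (hPB : ∀ i, sym (P * B i) = 0)
    (d : ℝ → Fin n → ℝ)
    (x xs : ℝ → Fin n → ℝ) (u us : ℝ → Fin m → ℝ)
    (hxsb : ∃ M, ∀ t, ‖xs t‖ ≤ M) (husb : ∃ M, ∀ t, ‖us t‖ ≤ M)
    (hx : ∀ t, HasDerivAt x (A *ᵥ x t + d t + ∑ i, u t i • (B i *ᵥ x t)) t)
    (hxs : ∀ t, HasDerivAt xs (A *ᵥ xs t + d t + ∑ i, us t i • (B i *ᵥ xs t)) t)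
    (y : ℝ → Fin m → ℝ)
    (hy : ∀ t i, y t i = xs t ⬝ᵥ ((B i)ᵀ *ᵥ (P *ᵥ x t))) :
    ∀ t, deriv (fun s => (1 / 2 : ℝ) * ((x s - xs s) ⬝ᵥ (P *ᵥ (x s - xs s)))) t
      ≤ (u t - us t) ⬝ᵥ y t := by
  intro t
  have hPt : Pᵀ = P := by simpa using hP.isHermitian.eq
  rw [(((hx t).fun_sub (hxs t)).half_quadraticForm hPt).deriv]
  have hy' (i : Fin m) : y t i = x t ⬝ᵥ ((P * B i) *ᵥ xs t) := by
    rw [hy, mulVec_mulVec, ← hPt, ← transpose_mul, hPt, mulVec_transpose, dotProduct_comm,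
      dotProduct_mulVec]
  have hdiff : A *ᵥ x t + d t + ∑ i, u t i • (B i *ᵥ x t)
      - (A *ᵥ xs t + d t + ∑ i, us t i • (B i *ᵥ xs t))
      = A *ᵥ (x t - xs t) + ∑ i, B i *ᵥ (u t i • x t - us t i • xs t) := by
    simp only [mulVec_sub, mulVec_smul, Finset.sum_sub_distrib]
    abel
  have hA : (x t - xs t) ⬝ᵥ ((P * A) *ᵥ (x t - xs t)) ≤ 0 := by
    have h := hPA.dotProduct_mulVec_nonneg (x t - xs t)
    rw [star_trivial, neg_mulVec, dotProduct_neg, dotProduct_sym_mulVec] at h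
    linarith
  have hB : (x t - xs t) ⬝ᵥ (P *ᵥ ∑ i, B i *ᵥ (u t i • x t - us t i • xs t))
      = (u t - us t) ⬝ᵥ y t := by
    rw [mulVec_sum, dotProduct_sum]
    refine Finset.sum_congr rfl fun i _ => ?_
    rw [mulVec_mulVec, sub_dotProduct_mulVec_of_sym_eq_zero (hPB i), hy', Pi.sub_apply]
  rw [hdiff, mulVec_add, dotProduct_add, mulVec_mulVec, hB]
  linarith
end

section
/- (Closed-loop L² estimates) Under the hypotheses of the closed-loop Lyapunov identity, for every closed-loop solution on [0,∞): ∫₀^∞ |y(t)|² dt ≤ W(x̃(0),z(0))/λ_min(K_p) and ∫₀^∞ x̃(t)ᵀQx̃(t) dt ≤ W(x̃(0),z(0)), where λ_min(K_p) > 0 is the smallest eigenvalue of K_p. In particular y and Q^{1/2}x̃ are square integrable on [0,∞). -/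
open Matrix MeasureTheory

open Set Filter Topology

theorem HasDerivAt.dotProduct_mulVec_self {k : ℕ} {M : Matrix (Fin k) (Fin k) ℝ} (hM : Mᵀ = M)
    {v : ℝ → Fin k → ℝ} {v' : Fin k → ℝ} {t : ℝ} (hv : HasDerivAt v v' t) :
    HasDerivAt (fun s => (1 / 2 : ℝ) * (v s ⬝ᵥ (M *ᵥ v s))) (v t ⬝ᵥ (M *ᵥ v')) t := by
  have hcoord := hasDerivAt_pi.1 hv
  have hMv : ∀ i, HasDerivAt (fun s => (M *ᵥ v s) i) ((M *ᵥ v') i) t := fun i =>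
    HasDerivAt.fun_sum (A := fun j s => M i j * v s j) (u := Finset.univ)
      fun j _ => (hcoord j).const_mul (M i j)
  have hsum : HasDerivAt (fun s => v s ⬝ᵥ (M *ᵥ v s))
      (∑ i, (v' i * (M *ᵥ v t) i + v t i * (M *ᵥ v') i)) t :=
    HasDerivAt.fun_sum fun i _ => (hcoord i).mul (hMv i)
  refine (hsum.const_mul (1 / 2 : ℝ)).congr_deriv ?_
  have hswap : v' ⬝ᵥ (M *ᵥ v t) = v t ⬝ᵥ (M *ᵥ v') := by
    rw [← dotProduct_transpose_mulVec, hM]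
  rw [Finset.sum_add_distrib]
  change 1 / 2 * (v' ⬝ᵥ (M *ᵥ v t) + v t ⬝ᵥ (M *ᵥ v')) = _
  rw [hswap]
  ring

theorem dotProduct_sym_mulVec_self {k : ℕ} (M : Matrix (Fin k) (Fin k) ℝ) (v : Fin k → ℝ) :
    v ⬝ᵥ (sym M *ᵥ v) = v ⬝ᵥ (M *ᵥ v) := by
  rw [sym, smul_mulVec, add_mulVec, dotProduct_smul, dotProduct_add, dotProduct_transpose_mulVec,
    smul_eq_mul]
  ring

theorem dotProduct_mulVec_self_eq_zero_of_sym_eq_zero {k : ℕ} {M : Matrix (Fin k) (Fin k) ℝ}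
    (hM : sym M = 0) (v : Fin k → ℝ) : v ⬝ᵥ (M *ᵥ v) = 0 := by
  rw [← dotProduct_sym_mulVec_self, hM, zero_mulVec, dotProduct_zero]

open scoped MatrixOrder Matrix.Norms.L2Operator in
theorem Matrix.IsHermitian.iInf_eigenvalues_mul_le {k : ℕ} {K : Matrix (Fin k) (Fin k) ℝ}
    (hK : K.IsHermitian) (v : Fin k → ℝ) :
    (⨅ i, hK.eigenvalues i) * ∑ i, v i ^ 2 ≤ v ⬝ᵥ (K *ᵥ v) := by
  have hle : algebraMap ℝ (Matrix (Fin k) (Fin k) ℝ) (⨅ i, hK.eigenvalues i) ≤ K := by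
    refine algebraMap_le_of_le_spectrum (fun r hr => ?_) hK
    rw [hK.spectrum_real_eq_range_eigenvalues] at hr
    obtain ⟨i, rfl⟩ := hr
    exact ciInf_le (finite_range _).bddBelow i
  have hnonneg := (Matrix.le_iff.1 hle).dotProduct_mulVec_nonneg v
  rw [Algebra.algebraMap_eq_smul_one, sub_mulVec, smul_mulVec, one_mulVec, dotProduct_sub,
    dotProduct_smul, star_trivial, smul_eq_mul] at hnonneg
  simpa only [sub_nonneg, dotProduct, ← sq] using hnonneg

theorem Matrix.PosDef.iInf_eigenvalues_pos {k : ℕ} (hk : 0 < k) {K : Matrix (Fin k) (Fin k) ℝ}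
    (hK : K.PosDef) : 0 < ⨅ i, hK.1.eigenvalues i := by
  have : Nonempty (Fin k) := ⟨⟨0, hk⟩⟩
  obtain ⟨i, hi⟩ := exists_eq_ciInf_of_finite (f := hK.1.eigenvalues)
  exact hi ▸ hK.eigenvalues_pos i

/-- A nonnegative function with derivative `-g ≤ 0` on `[0, ∞)` bounds the integral of `g`. -/
theorem integrableOn_and_integral_le_of_hasDerivAt_neg {W g : ℝ → ℝ} (hW : ∀ t, 0 ≤ W t)
    (hderiv : ∀ t, 0 ≤ t → HasDerivAt W (-g t) t) (hg : ∀ t, 0 ≤ g t) :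
    IntegrableOn g (Ioi 0) ∧ ∫ t in Ioi (0 : ℝ), g t ≤ W 0 := by
  have hanti : AntitoneOn W (Ici 0) := by
    refine antitoneOn_of_deriv_nonpos (convex_Ici 0)
      (fun t ht => (hderiv t ht).continuousAt.continuousWithinAt)
      (fun t ht => (hderiv t (interior_subset ht)).differentiableAt.differentiableWithinAt)
      fun t ht => ?_
    rw [(hderiv t (interior_subset ht)).deriv]
    exact neg_nonpos.2 (hg t)
  have hanti_max : Antitone fun t => W (max t 0) := fun a b hab =>
    hanti (le_max_right a 0) (le_max_right b 0) (max_le_max_right 0 hab)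
  have hlim : Tendsto W atTop (𝓝 (⨅ t, W (max t 0))) := by
    refine (tendsto_atTop_ciInf hanti_max ⟨0, ?_⟩).congr' ?_
    · rintro _ ⟨t, rfl⟩
      exact hW _
    · filter_upwards [eventually_ge_atTop 0] with t ht
      rw [max_eq_left ht]
  have hneg : ∀ t ∈ Ioi (0 : ℝ), -g t ≤ 0 := fun t _ => neg_nonpos.2 (hg t)
  refine ⟨integrable_neg_iff.1 (integrableOn_Ioi_deriv_of_nonpos' hderiv hneg hlim), ?_⟩
  have hintegrable := integral_Ioi_of_hasDerivAt_of_nonpos' hderiv hneg hlim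
  rw [integral_neg] at hintegrable
  linarith [le_ciInf fun t => hW (max t 0)]

/-- Along the error dynamics the storage function `x̃ᵀPx̃ / 2` has rate `-x̃ᵀQx̃ + ũᵀy`. -/
theorem dotProduct_mulVec_error_dynamics {n m : ℕ} {A P : Matrix (Fin n) (Fin n) ℝ}
    {B : Fin m → Matrix (Fin n) (Fin n) ℝ} (hP : Pᵀ = P) (hPB : ∀ i, sym (P * B i) = 0)
    (d x xs : Fin n → ℝ) (u us : Fin m → ℝ) :
    (x - xs) ⬝ᵥ (P *ᵥ ((A *ᵥ x + d + ∑ i, u i • (B i *ᵥ x)) -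
        (A *ᵥ xs + d + ∑ i, us i • (B i *ᵥ xs)))) =
      -((x - xs) ⬝ᵥ ((-sym (P * A)) *ᵥ (x - xs))) +
        (u - us) ⬝ᵥ fun i => xs ⬝ᵥ ((B i)ᵀ *ᵥ (P *ᵥ x)) := by
  have hsplit : (A *ᵥ x + d + ∑ i, u i • (B i *ᵥ x)) - (A *ᵥ xs + d + ∑ i, us i • (B i *ᵥ xs)) =
      A *ᵥ (x - xs) + ∑ i, (u i • (B i *ᵥ x) - us i • (B i *ᵥ xs)) := by
    rw [mulVec_sub, Finset.sum_sub_distrib]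
    abel
  rw [hsplit, mulVec_add, dotProduct_add, mulVec_mulVec, neg_mulVec, dotProduct_neg, neg_neg,
    dotProduct_sym_mulVec_self, mulVec_sum, dotProduct_sum]
  congr 1
  refine Finset.sum_congr rfl fun i _ => ?_
  have hx := dotProduct_mulVec_self_eq_zero_of_sym_eq_zero (hPB i) x
  have hxs := dotProduct_mulVec_self_eq_zero_of_sym_eq_zero (hPB i) xs
  have hdiff := dotProduct_mulVec_self_eq_zero_of_sym_eq_zero (hPB i) (x - xs)
  have hout : xs ⬝ᵥ ((B i)ᵀ *ᵥ (P *ᵥ x)) = x ⬝ᵥ ((P * B i) *ᵥ xs) := by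
    rw [mulVec_mulVec, ← dotProduct_transpose_mulVec, transpose_mul, transpose_transpose, hP]
  beta_reduce
  rw [hout]
  simp only [mulVec_sub, mulVec_smul, mulVec_mulVec, sub_dotProduct, dotProduct_sub,
    dotProduct_smul, smul_eq_mul, Pi.sub_apply] at hdiff ⊢
  linear_combination u i * hx + us i * hxs + u i * (hdiff - hx - hxs)

/-- **closed-loop L² estimates.** Under the hypotheses of the closed-loop
Lyapunov identity, for every closed-loop solution on `[0, ∞)`:
`∫₀^∞ |y(t)|² dt ≤ W(x̃(0), z(0)) / λ_min(Kₚ)` and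
`∫₀^∞ x̃(t)ᵀ Q x̃(t) dt ≤ W(x̃(0), z(0))`, where `λ_min(Kₚ) > 0` is the smallest
eigenvalue of `Kₚ` and `|y|² = Σᵢ yᵢ²` is the squared Euclidean norm. In particular `|y|²`
and `x̃ᵀ Q x̃ = |Q^{1/2} x̃|²` are integrable on `(0, ∞)`. -/
theorem stmt_8 {n m : ℕ} (hm : 0 < m)
    (A : Matrix (Fin n) (Fin n) ℝ) (B : Fin m → Matrix (Fin n) (Fin n) ℝ)
    (P : Matrix (Fin n) (Fin n) ℝ) (hP : P.PosDef)
    (hPA : (-sym (P * A)).PosSemidef)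
    (hPB : ∀ i, sym (P * B i) = 0)
    (d : ℝ → Fin n → ℝ)
    (x xs : ℝ → Fin n → ℝ) (u us : ℝ → Fin m → ℝ)
    (hxsb : ∃ M, ∀ t, ‖xs t‖ ≤ M) (husb : ∃ M, ∀ t, ‖us t‖ ≤ M)
    (Kp Ki : Matrix (Fin m) (Fin m) ℝ) (hKp : Kp.PosDef) (hKi : Ki.PosDef)
    (z : ℝ → Fin m → ℝ) (y : ℝ → Fin m → ℝ)
    (hy : ∀ t i, y t i = xs t ⬝ᵥ ((B i)ᵀ *ᵥ (P *ᵥ x t)))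
    (hz : ∀ t, 0 ≤ t → HasDerivAt z (-(y t)) t)
    (hu : ∀ t, u t = -(Kp *ᵥ y t) + Ki *ᵥ z t + us t)
    (hx : ∀ t, 0 ≤ t → HasDerivAt x (A *ᵥ x t + d t + ∑ i, u t i • (B i *ᵥ x t)) t)
    (hxs : ∀ t, HasDerivAt xs (A *ᵥ xs t + d t + ∑ i, us t i • (B i *ᵥ xs t)) t) :
    0 < (⨅ i, hKp.1.eigenvalues i) ∧
    IntegrableOn (fun t => ∑ i, (y t i) ^ 2) (Set.Ioi (0 : ℝ)) ∧
    IntegrableOn (fun t => (x t - xs t) ⬝ᵥ ((-sym (P * A)) *ᵥ (x t - xs t)))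
      (Set.Ioi (0 : ℝ)) ∧
    (∫ t in Set.Ioi (0 : ℝ), ∑ i, (y t i) ^ 2)
      ≤ ((1 / 2 : ℝ) * ((x 0 - xs 0) ⬝ᵥ (P *ᵥ (x 0 - xs 0)))
          + (1 / 2 : ℝ) * (z 0 ⬝ᵥ (Ki *ᵥ z 0))) / (⨅ i, hKp.1.eigenvalues i) ∧
    (∫ t in Set.Ioi (0 : ℝ), (x t - xs t) ⬝ᵥ ((-sym (P * A)) *ᵥ (x t - xs t)))
      ≤ (1 / 2 : ℝ) * ((x 0 - xs 0) ⬝ᵥ (P *ᵥ (x 0 - xs 0)))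
          + (1 / 2 : ℝ) * (z 0 ⬝ᵥ (Ki *ᵥ z 0)) := by
  have hPt : Pᵀ = P := hP.1
  have hKit : Kiᵀ = Ki := hKi.1
  set Q := -sym (P * A)
  set W : ℝ → ℝ := fun t => (1 / 2 : ℝ) * ((x t - xs t) ⬝ᵥ (P *ᵥ (x t - xs t)))
    + (1 / 2 : ℝ) * (z t ⬝ᵥ (Ki *ᵥ z t))
  set q : ℝ → ℝ := fun t => (x t - xs t) ⬝ᵥ (Q *ᵥ (x t - xs t))
  have hW : ∀ t, 0 ≤ W t := fun t => by
    have hPnonneg := hP.posSemidef.dotProduct_mulVec_nonneg (x t - xs t)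
    have hKinonneg := hKi.posSemidef.dotProduct_mulVec_nonneg (z t)
    rw [star_trivial] at hPnonneg hKinonneg
    positivity
  have hq : ∀ t, 0 ≤ q t := fun t => by
    simpa only [star_trivial] using hPA.dotProduct_mulVec_nonneg (x t - xs t)
  have hKpy : ∀ t, 0 ≤ y t ⬝ᵥ (Kp *ᵥ y t) := fun t => by
    simpa only [star_trivial] using hKp.posSemidef.dotProduct_mulVec_nonneg (y t)
  have hderiv : ∀ t, 0 ≤ t → HasDerivAt W (-(q t + y t ⬝ᵥ (Kp *ᵥ y t))) t := fun t ht => by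
    refine ((((hx t ht).sub (hxs t)).dotProduct_mulVec_self hPt).add
      ((hz t ht).dotProduct_mulVec_self hKit)).congr_deriv ?_
    have hyt : (fun i => xs t ⬝ᵥ ((B i)ᵀ *ᵥ (P *ᵥ x t))) = y t := funext fun i => (hy t i).symm
    have hut : u t - us t = -(Kp *ᵥ y t) + Ki *ᵥ z t := by rw [hu t, add_sub_cancel_right]
    have hcross : z t ⬝ᵥ (Ki *ᵥ y t) = (Ki *ᵥ z t) ⬝ᵥ y t := by
      rw [dotProduct_comm (Ki *ᵥ z t), ← dotProduct_transpose_mulVec, hKit]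
    rw [Pi.sub_apply, dotProduct_mulVec_error_dynamics hPt hPB, hyt, hut, mulVec_neg,
      dotProduct_neg, add_dotProduct, neg_dotProduct, hcross, dotProduct_comm (Kp *ᵥ y t)]
    ring
  obtain ⟨hintegrable, hle⟩ := integrableOn_and_integral_le_of_hasDerivAt_neg hW hderiv
    fun t => add_nonneg (hq t) (hKpy t)
  have hxc : ContinuousOn x (Ioi 0) := fun t ht =>
    (hx t (le_of_lt ht)).continuousAt.continuousWithinAt
  have hxsc : ContinuousOn xs (Ioi 0) := fun t _ => (hxs t).continuousAt.continuousWithinAt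
  have hqc : ContinuousOn q (Ioi 0) := by
    have hquad : Continuous fun v : Fin n → ℝ => v ⬝ᵥ (Q *ᵥ v) := by fun_prop
    exact hquad.comp_continuousOn (hxc.sub hxsc)
  have hyc : ContinuousOn (fun t => ∑ i, y t i ^ 2) (Ioi 0) := by
    have hout : Continuous fun p : (Fin n → ℝ) × (Fin n → ℝ) =>
        ∑ i, (p.2 ⬝ᵥ ((B i)ᵀ *ᵥ (P *ᵥ p.1))) ^ 2 := by fun_prop
    refine (hout.comp_continuousOn (hxc.prodMk hxsc)).congr fun t _ => ?_
    simp only [Function.comp_apply, hy]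
  have hlam := hKp.iInf_eigenvalues_pos hm
  set lam := ⨅ i, hKp.1.eigenvalues i
  have hysq : ∀ t, 0 ≤ ∑ i, y t i ^ 2 := fun t => Finset.sum_nonneg fun i _ => sq_nonneg _
  have hlam_le : ∀ t, lam * ∑ i, y t i ^ 2 ≤ q t + y t ⬝ᵥ (Kp *ᵥ y t) := fun t =>
    (hKp.1.iInf_eigenvalues_mul_le (y t)).trans (le_add_of_nonneg_left (hq t))
  have hq_le : ∀ t, q t ≤ q t + y t ⬝ᵥ (Kp *ᵥ y t) := fun t => le_add_of_nonneg_right (hKpy t)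
  have hlam_int : IntegrableOn (fun t => lam * ∑ i, y t i ^ 2) (Ioi 0) :=
    hintegrable.mono' ((hyc.const_mul lam).aestronglyMeasurable measurableSet_Ioi)
      (ae_of_all _ fun t => by
        rw [Real.norm_of_nonneg (mul_nonneg hlam.le (hysq t))]
        exact hlam_le t)
  have hq_int : IntegrableOn q (Ioi 0) :=
    hintegrable.mono' (hqc.aestronglyMeasurable measurableSet_Ioi) (ae_of_all _ fun t => by
      rw [Real.norm_of_nonneg (hq t)]
      exact hq_le t)
  refine ⟨hlam, (integrable_const_mul_iff hlam.ne'.isUnit _).1 hlam_int, hq_int, ?_,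
    (integral_mono hq_int hintegrable hq_le).trans hle⟩
  rw [le_div_iff₀' hlam, ← integral_const_mul]
  exact (integral_mono hlam_int hintegrable hlam_le).trans hle
end
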